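/- arXiv:1809.04565 — 8 statements merged into one kernel-verified Lean document; each statement's English description precedes it below -/
import Mathlib

section
/- Suppose l₁ < u₁ and l₂ < u₂. Then the strengthened (TLM) relaxation set S_QC equals S, i.e., the set of points (z, x₁, x₂, x₃, x₄) admitting the λᶜ/λˢ extreme-point representation with the linking constraint is exactly the convex hull of the 16 points {(φ(γ), γ) : γ a vertex of B}, where φ(x₁,x₂,x₃,x₄) = α_c x₁x₂x₃ + α_s x₁x₂x₄. -/
open Finset Real

noncomputable section

/-- Vertices of the box `[l1,u1] × [l2,u2] × [l3,u3]` in lexicographic order. -/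
def xiC (l1 u1 l2 u2 l3 u3 : ℝ) : Fin 8 → ℝ × ℝ × ℝ :=
  ![(l1, l2, l3), (l1, l2, u3), (l1, u2, l3), (l1, u2, u3),
    (u1, l2, l3), (u1, l2, u3), (u1, u2, l3), (u1, u2, u3)]

/-- The trilinear product of the coordinates of a point of `ℝ³`. -/
def tri (p : ℝ × ℝ × ℝ) : ℝ := p.1 * p.2.1 * p.2.2

/-- The linking constraint between the multipliers `lc` and `ls`. -/
def Linking (l1 u1 l2 u2 : ℝ) (lc ls : Fin 8 → ℝ) : Prop :=
    (lc 0 + lc 1 - ls 0 - ls 1) * (l1 * l2)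
  + (lc 2 + lc 3 - ls 2 - ls 3) * (l1 * u2)
  + (lc 4 + lc 5 - ls 4 - ls 5) * (u1 * l2)
  + (lc 6 + lc 7 - ls 6 - ls 7) * (u1 * u2) = 0

/-- The sum of two trilinear terms sharing the first two variables. -/
def phi (ac as : ℝ) (x : ℝ × ℝ × ℝ × ℝ) : ℝ :=
  ac * (x.1 * x.2.1 * x.2.2.1) + as * (x.1 * x.2.1 * x.2.2.2)

/-- The box `B = [l1,u1] × [l2,u2] × [l3,u3] × [l4,u4] ⊆ ℝ⁴`. -/
def boxB (l1 u1 l2 u2 l3 u3 l4 u4 : ℝ) : Set (ℝ × ℝ × ℝ × ℝ) :=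
  {x | x.1 ∈ Set.Icc l1 u1 ∧ x.2.1 ∈ Set.Icc l2 u2 ∧
       x.2.2.1 ∈ Set.Icc l3 u3 ∧ x.2.2.2 ∈ Set.Icc l4 u4}

/-- The set of vertices of the box `B`. -/
def vertB (l1 u1 l2 u2 l3 u3 l4 u4 : ℝ) : Set (ℝ × ℝ × ℝ × ℝ) :=
  {x | (x.1 = l1 ∨ x.1 = u1) ∧ (x.2.1 = l2 ∨ x.2.1 = u2) ∧
       (x.2.2.1 = l3 ∨ x.2.2.1 = u3) ∧ (x.2.2.2 = l4 ∨ x.2.2.2 = u4)}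

/-- The strengthened (TLM) relaxation set `S_QC ⊆ ℝ⁵`. -/
def SQC (l1 u1 l2 u2 l3 u3 l4 u4 ac as : ℝ) : Set (ℝ × ℝ × ℝ × ℝ × ℝ) :=
  {p | ∃ lc ls : Fin 8 → ℝ,
    lc ∈ stdSimplex ℝ (Fin 8) ∧ ls ∈ stdSimplex ℝ (Fin 8) ∧
    (p.2.1, p.2.2.1, p.2.2.2.1) = ∑ k, lc k • xiC l1 u1 l2 u2 l3 u3 k ∧
    (p.2.1, p.2.2.1, p.2.2.2.2) = ∑ k, ls k • xiC l1 u1 l2 u2 l4 u4 k ∧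
    p.1 = ac * ∑ k, lc k * tri (xiC l1 u1 l2 u2 l3 u3 k)
        + as * ∑ k, ls k * tri (xiC l1 u1 l2 u2 l4 u4 k) ∧
    Linking l1 u1 l2 u2 lc ls}

/-- `S`: the convex hull of the 16 points `(φ(γ), γ)`, `γ` a vertex of `B`. -/
def Shull (l1 u1 l2 u2 l3 u3 l4 u4 ac as : ℝ) : Set (ℝ × ℝ × ℝ × ℝ × ℝ) :=
  convexHull ℝ ((fun x => (phi ac as x, x)) '' vertB l1 u1 l2 u2 l3 u3 l4 u4)

/-- Nonnegative weights at the ends of an interval can be merged at a point of the interval. -/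
lemma exists_merge_weights {l u m n : ℝ} (h : l ≤ u) (hm : 0 ≤ m) (hn : 0 ≤ n) :
    ∃ c ∈ Set.Icc l u, m * l + n * u = (m + n) * c := by
  rcases (add_nonneg hm hn).eq_or_lt with h0 | h0
  · have hm0 : m = 0 := by linarith
    have hn0 : n = 0 := by linarith
    exact ⟨l, ⟨le_rfl, h⟩, by simp [hm0, hn0]⟩
  · refine ⟨(m * l + n * u) / (m + n), ⟨?_, ?_⟩, by field_simp⟩
    · rw [le_div_iff₀ h0]
      nlinarith
    · rw [div_le_iff₀ h0]
      nlinarith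

/-- The graph of `phi` over a face of the box with the first two coordinates fixed at bounds
lies in the convex hull of the graph over the vertices. -/
lemma phi_mem_Shull {l1 u1 l2 u2 l3 u3 l4 u4 ac as a b c s : ℝ}
    (ha : a = l1 ∨ a = u1) (hb : b = l2 ∨ b = u2)
    (hc : c ∈ Set.Icc l3 u3) (hs : s ∈ Set.Icc l4 u4) :
    (phi ac as (a, b, c, s), a, b, c, s) ∈ Shull l1 u1 l2 u2 l3 u3 l4 u4 ac as := by
  have hvert : ∀ c' s', (c' = l3 ∨ c' = u3) → (s' = l4 ∨ s' = u4) →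
      (phi ac as (a, b, c', s'), a, b, c', s') ∈ Shull l1 u1 l2 u2 l3 u3 l4 u4 ac as :=
    fun c' s' hc' hs' => subset_convexHull ℝ _ ⟨(a, b, c', s'), ⟨ha, hb, hc', hs'⟩, rfl⟩
  have hconv : Convex ℝ (Shull l1 u1 l2 u2 l3 u3 l4 u4 ac as) := convex_convexHull ℝ _
  have hedge : ∀ c', (c' = l3 ∨ c' = u3) →
      (phi ac as (a, b, c', s), a, b, c', s) ∈ Shull l1 u1 l2 u2 l3 u3 l4 u4 ac as := by
    intro c' hc'
    rw [← segment_eq_Icc (hs.1.trans hs.2)] at hs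
    obtain ⟨t, t', ht, ht', htt, rfl⟩ := hs
    obtain rfl : t' = 1 - t := by linarith
    convert hconv (hvert c' l4 hc' (.inl rfl)) (hvert c' u4 hc' (.inr rfl)) ht ht' htt using 1
    simp only [phi, Prod.smul_mk, Prod.mk_add_mk, smul_eq_mul, Prod.mk.injEq]
    refine ⟨?_, ?_, ?_, ?_, ?_⟩ <;> first | trivial | ring
  rw [← segment_eq_Icc (hc.1.trans hc.2)] at hc
  obtain ⟨t, t', ht, ht', htt, rfl⟩ := hc
  obtain rfl : t' = 1 - t := by linarith
  convert hconv (hedge l3 (.inl rfl)) (hedge u3 (.inr rfl)) ht ht' htt using 1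
  simp only [phi, Prod.smul_mk, Prod.mk_add_mk, smul_eq_mul, Prod.mk.injEq]
  refine ⟨?_, ?_, ?_, ?_, ?_⟩ <;> first | trivial | ring

lemma convex_SQC (l1 u1 l2 u2 l3 u3 l4 u4 ac as : ℝ) :
    Convex ℝ (SQC l1 u1 l2 u2 l3 u3 l4 u4 ac as) := by
  rintro ⟨z, x1, x2, x3, x4⟩ ⟨lc, ls, hlc, hls, hc, hs, hz, hL⟩
    ⟨z', x1', x2', x3', x4'⟩ ⟨lc', ls', hlc', hls', hc', hs', hz', hL'⟩ a b ha hb hab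
  refine ⟨a • lc + b • lc', a • ls + b • ls', convex_stdSimplex ℝ _ hlc hlc' ha hb hab,
    convex_stdSimplex ℝ _ hls hls' ha hb hab, ?_, ?_, ?_, ?_⟩
  · simp only [Pi.add_apply, Pi.smul_apply, add_smul, smul_assoc, sum_add_distrib, ← smul_sum,
      ← hc, ← hc']
    rfl
  · simp only [Pi.add_apply, Pi.smul_apply, add_smul, smul_assoc, sum_add_distrib, ← smul_sum,
      ← hs, ← hs']
    rfl
  · simp only [Pi.add_apply, Pi.smul_apply, smul_eq_mul, add_mul, mul_assoc, sum_add_distrib,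
      ← mul_sum, Prod.smul_mk, Prod.mk_add_mk] at hz hz' ⊢
    linear_combination a * hz + b * hz'
  · simp only [Linking, Pi.add_apply, Pi.smul_apply, smul_eq_mul] at hL hL' ⊢
    linear_combination a * hL + b * hL'

lemma vertex_mem_SQC {l1 u1 l2 u2 l3 u3 l4 u4 : ℝ} (ac as : ℝ) {x : ℝ × ℝ × ℝ × ℝ}
    (hx : x ∈ vertB l1 u1 l2 u2 l3 u3 l4 u4) :
    (phi ac as x, x) ∈ SQC l1 u1 l2 u2 l3 u3 l4 u4 ac as := by
  have key : ∀ i j : Fin 8, (i : ℕ) / 2 = (j : ℕ) / 2 →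
      (x.1, x.2.1, x.2.2.1) = xiC l1 u1 l2 u2 l3 u3 i →
      (x.1, x.2.1, x.2.2.2) = xiC l1 u1 l2 u2 l4 u4 j →
      (phi ac as x, x) ∈ SQC l1 u1 l2 u2 l3 u3 l4 u4 ac as := by
    intro i j hij hi hj
    refine ⟨Pi.single i 1, Pi.single j 1, single_mem_stdSimplex ℝ i, single_mem_stdSimplex ℝ j,
      ?_, ?_, ?_, ?_⟩
    · simpa [Pi.single_apply] using hi
    · simpa [Pi.single_apply] using hj
    · simp [Pi.single_apply, ← hi, ← hj, phi, tri]
    · unfold Linking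
      fin_cases i <;> fin_cases j <;> simp at hij ⊢
  obtain ⟨x1, x2, x3, x4⟩ := x
  obtain ⟨h1, h2, h3, h4⟩ := hx
  dsimp only at h1 h2 h3 h4 key
  rcases h1 with rfl | rfl <;> rcases h2 with rfl | rfl
  · rcases h3 with rfl | rfl <;> rcases h4 with rfl | rfl
    exacts [key 0 0 rfl rfl rfl, key 0 1 rfl rfl rfl, key 1 0 rfl rfl rfl, key 1 1 rfl rfl rfl]
  · rcases h3 with rfl | rfl <;> rcases h4 with rfl | rfl
    exacts [key 2 2 rfl rfl rfl, key 2 3 rfl rfl rfl, key 3 2 rfl rfl rfl, key 3 3 rfl rfl rfl]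
  · rcases h3 with rfl | rfl <;> rcases h4 with rfl | rfl
    exacts [key 4 4 rfl rfl rfl, key 4 5 rfl rfl rfl, key 5 4 rfl rfl rfl, key 5 5 rfl rfl rfl]
  · rcases h3 with rfl | rfl <;> rcases h4 with rfl | rfl
    exacts [key 6 6 rfl rfl rfl, key 6 7 rfl rfl rfl, key 7 6 rfl rfl rfl, key 7 7 rfl rfl rfl]

/-- A signed weight on the vertices of a nondegenerate rectangle is zero if it has zero mass
and integrates both coordinates and their product to zero. -/
lemma rectangle_weights_eq_zero {l1 u1 l2 u2 d0 d1 d2 d3 : ℝ} (h1 : l1 < u1) (h2 : l2 < u2)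
    (hd : d0 + d1 + d2 + d3 = 0) (hx : (d0 + d1) * l1 + (d2 + d3) * u1 = 0)
    (hy : (d0 + d2) * l2 + (d1 + d3) * u2 = 0)
    (hxy : d0 * (l1 * l2) + d1 * (l1 * u2) + d2 * (u1 * l2) + d3 * (u1 * u2) = 0) :
    d0 = 0 ∧ d1 = 0 ∧ d2 = 0 ∧ d3 = 0 := by
  have h1' : u1 - l1 ≠ 0 := (sub_pos.2 h1).ne'
  have h2' : u2 - l2 ≠ 0 := (sub_pos.2 h2).ne'
  have hr : d2 + d3 = 0 := by
    apply mul_right_cancel₀ h1'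
    linear_combination hx - l1 * hd
  have ht : d1 + d3 = 0 := by
    apply mul_right_cancel₀ h2'
    linear_combination hy - l2 * hd
  have h3 : d3 = 0 := by
    apply mul_right_cancel₀ (mul_ne_zero h1' h2')
    linear_combination hxy - l2 * hx - l1 * hy + l1 * l2 * hd
  refine ⟨?_, ?_, ?_, h3⟩ <;> linarith

lemma SQC_subset_Shull {l1 u1 l2 u2 l3 u3 l4 u4 : ℝ} (ac as : ℝ)
    (h1 : l1 < u1) (h2 : l2 < u2) (h3 : l3 ≤ u3) (h4 : l4 ≤ u4) :
    SQC l1 u1 l2 u2 l3 u3 l4 u4 ac as ⊆ Shull l1 u1 l2 u2 l3 u3 l4 u4 ac as := by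
  rintro ⟨z, x1, x2, x3, x4⟩ ⟨lc, ls, ⟨hlc, hlc1⟩, ⟨hls, hls1⟩, hc, hs, hz, hL⟩
  simp only [Fin.sum_univ_eight, xiC, tri, Matrix.cons_val, Prod.smul_mk, Prod.mk_add_mk,
    smul_eq_mul, Prod.mk.injEq] at hlc1 hls1 hc hs hz
  unfold Linking at hL
  obtain ⟨hc1, hc2, hc3⟩ := hc
  obtain ⟨hs1, hs2, hs4⟩ := hs
  obtain ⟨e0, e1, e2, e3⟩ := rectangle_weights_eq_zero h1 h2
    (d0 := lc 0 + lc 1 - ls 0 - ls 1) (d1 := lc 2 + lc 3 - ls 2 - ls 3)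
    (d2 := lc 4 + lc 5 - ls 4 - ls 5) (d3 := lc 6 + lc 7 - ls 6 - ls 7)
    (by linear_combination hlc1 - hls1) (by linear_combination hs1 - hc1)
    (by linear_combination hs2 - hc2) hL
  obtain ⟨c0, hc0I, hc0⟩ := exists_merge_weights h3 (hlc 0) (hlc 1)
  obtain ⟨c1, hc1I, hc1'⟩ := exists_merge_weights h3 (hlc 2) (hlc 3)
  obtain ⟨c2, hc2I, hc2'⟩ := exists_merge_weights h3 (hlc 4) (hlc 5)
  obtain ⟨c3, hc3I, hc3'⟩ := exists_merge_weights h3 (hlc 6) (hlc 7)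
  obtain ⟨s0, hs0I, hs0⟩ := exists_merge_weights h4 (hls 0) (hls 1)
  obtain ⟨s1, hs1I, hs1'⟩ := exists_merge_weights h4 (hls 2) (hls 3)
  obtain ⟨s2, hs2I, hs2'⟩ := exists_merge_weights h4 (hls 4) (hls 5)
  obtain ⟨s3, hs3I, hs3'⟩ := exists_merge_weights h4 (hls 6) (hls 7)
  have hconv : Convex ℝ (Shull l1 u1 l2 u2 l3 u3 l4 u4 ac as) := convex_convexHull ℝ _
  have hmem := hconv.sum_mem (t := univ)
    (w := ![lc 0 + lc 1, lc 2 + lc 3, lc 4 + lc 5, lc 6 + lc 7])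
    (z := ![(phi ac as (l1, l2, c0, s0), l1, l2, c0, s0),
      (phi ac as (l1, u2, c1, s1), l1, u2, c1, s1),
      (phi ac as (u1, l2, c2, s2), u1, l2, c2, s2),
      (phi ac as (u1, u2, c3, s3), u1, u2, c3, s3)])
    (by
      intro i _
      fin_cases i
      exacts [add_nonneg (hlc 0) (hlc 1), add_nonneg (hlc 2) (hlc 3),
        add_nonneg (hlc 4) (hlc 5), add_nonneg (hlc 6) (hlc 7)])
    (by
      simp only [Fin.sum_univ_four, Matrix.cons_val]
      linarith)
    (by
      intro i _
      fin_cases i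
      exacts [phi_mem_Shull (.inl rfl) (.inl rfl) hc0I hs0I,
        phi_mem_Shull (.inl rfl) (.inr rfl) hc1I hs1I,
        phi_mem_Shull (.inr rfl) (.inl rfl) hc2I hs2I,
        phi_mem_Shull (.inr rfl) (.inr rfl) hc3I hs3I])
  convert hmem using 1
  simp only [Fin.sum_univ_four, Matrix.cons_val, phi, Prod.smul_mk, Prod.mk_add_mk,
    smul_eq_mul, Prod.mk.injEq]
  refine ⟨?_, ?_, ?_, ?_, ?_⟩
  · linear_combination hz + ac * (l1 * l2 * hc0 + l1 * u2 * hc1' + u1 * l2 * hc2' + u1 * u2 * hc3')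
      + as * (l1 * l2 * (hs0 - s0 * e0) + l1 * u2 * (hs1' - s1 * e1)
        + u1 * l2 * (hs2' - s2 * e2) + u1 * u2 * (hs3' - s3 * e3))
  · linear_combination hc1
  · linear_combination hc2
  · linear_combination hc3 + hc0 + hc1' + hc2' + hc3'
  · linear_combination hs4 + hs0 + hs1' + hs2' + hs3' - s0 * e0 - s1 * e1 - s2 * e2 - s3 * e3

/-- if `l₁ < u₁` and `l₂ < u₂`, then `S_QC = S`. -/
theorem SQC_eq_Shull (l1 u1 l2 u2 l3 u3 l4 u4 ac as : ℝ)
    (h1 : l1 < u1) (h2 : l2 < u2) (h3 : l3 ≤ u3) (h4 : l4 ≤ u4) :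
    SQC l1 u1 l2 u2 l3 u3 l4 u4 ac as = Shull l1 u1 l2 u2 l3 u3 l4 u4 ac as := by
  apply Set.Subset.antisymm (SQC_subset_Shull ac as h1 h2 h3 h4)
  refine convexHull_min ?_ (convex_SQC l1 u1 l2 u2 l3 u3 l4 u4 ac as)
  rintro _ ⟨x, hx, rfl⟩
  exact vertex_mem_SQC ac as hx
end
end

section
/- (Lemma 1) Suppose l₁ < u₁ and l₂ < u₂. Let λᶜ, λˢ ∈ Δ₈ satisfy the linking constraint and represent the same first two coordinates, i.e. Σ_k λᶜ_k (ξᶜ_k)₁ = Σ_k λˢ_k (ξˢ_k)₁ and Σ_k λᶜ_k (ξᶜ_k)₂ = Σ_k λˢ_k (ξˢ_k)₂. Then for each j = 1, 2, 3, 4 one has λᶜ_{2j−1} + λᶜ_{2j} = λˢ_{2j−1} + λˢ_{2j}. -/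
open Finset Real

noncomputable section

/-- Weights on the four vertices of a nondegenerate rectangle vanish once their moments against
`1`, `x`, `y` and `x * y` do. -/
theorem eq_zero_of_vertex_moments_eq_zero {l1 u1 l2 u2 a b c d : ℝ} (h1 : l1 ≠ u1) (h2 : l2 ≠ u2)
    (hsum : a + b + c + d = 0)
    (hx : (a + b) * l1 + (c + d) * u1 = 0)
    (hy : (a + c) * l2 + (b + d) * u2 = 0)
    (hxy : a * (l1 * l2) + b * (l1 * u2) + c * (u1 * l2) + d * (u1 * u2) = 0) :
    a = 0 ∧ b = 0 ∧ c = 0 ∧ d = 0 := by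
  have n1 : u1 - l1 ≠ 0 := sub_ne_zero.mpr h1.symm
  have n2 : u2 - l2 ≠ 0 := sub_ne_zero.mpr h2.symm
  have hcd : c + d = 0 := by
    apply (mul_eq_zero.mp _).resolve_right n1
    linear_combination hx - l1 * hsum
  have hbd : b + d = 0 := by
    apply (mul_eq_zero.mp _).resolve_right n2
    linear_combination hy - l2 * hsum
  have hd : d = 0 := by
    apply (mul_eq_zero.mp _).resolve_right (mul_ne_zero n1 n2)
    linear_combination hxy - l1 * hy - l2 * hx + l1 * l2 * hsum
  refine ⟨?_, ?_, ?_, hd⟩ <;> linarith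

/-- Lemma 1: if `l₁ < u₁`, `l₂ < u₂`, `λᶜ, λˢ ∈ Δ₈` satisfy the linking
constraint and represent the same first two coordinates, then
`λᶜ_{2j-1} + λᶜ_{2j} = λˢ_{2j-1} + λˢ_{2j}` for `j = 1, 2, 3, 4`. -/
theorem pairwise_sums_eq (l1 u1 l2 u2 l3 u3 l4 u4 : ℝ)
    (h1 : l1 < u1) (h2 : l2 < u2) (h3 : l3 ≤ u3) (h4 : l4 ≤ u4)
    (lc ls : Fin 8 → ℝ)
    (hlc : lc ∈ stdSimplex ℝ (Fin 8)) (hls : ls ∈ stdSimplex ℝ (Fin 8))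
    (hlink : Linking l1 u1 l2 u2 lc ls)
    (hx1 : ∑ k, lc k * (xiC l1 u1 l2 u2 l3 u3 k).1
         = ∑ k, ls k * (xiC l1 u1 l2 u2 l4 u4 k).1)
    (hx2 : ∑ k, lc k * (xiC l1 u1 l2 u2 l3 u3 k).2.1
         = ∑ k, ls k * (xiC l1 u1 l2 u2 l4 u4 k).2.1) :
    lc 0 + lc 1 = ls 0 + ls 1 ∧ lc 2 + lc 3 = ls 2 + ls 3 ∧
    lc 4 + lc 5 = ls 4 + ls 5 ∧ lc 6 + lc 7 = ls 6 + ls 7 := by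
  have hsc := hlc.2
  have hss := hls.2
  simp only [Fin.sum_univ_eight] at hsc hss
  simp [Fin.sum_univ_eight, xiC] at hx1 hx2
  unfold Linking at hlink
  obtain ⟨ha, hb, hc, hd⟩ := eq_zero_of_vertex_moments_eq_zero h1.ne h2.ne
    (a := lc 0 + lc 1 - ls 0 - ls 1) (b := lc 2 + lc 3 - ls 2 - ls 3)
    (c := lc 4 + lc 5 - ls 4 - ls 5) (d := lc 6 + lc 7 - ls 6 - ls 7)
    (by linarith) (by linarith) (by linarith) hlink
  refine ⟨?_, ?_, ?_, ?_⟩ <;> linarith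
end
end

section
/- (Extreme-point representation of a trilinear term, TRI-CONV) The set {(w, x₁, x₂, x₃) ∈ ℝ⁴ : there exists λ ∈ Δ₈ with (x₁, x₂, x₃) = Σ_k λ_k ξ_k and w = Σ_k λ_k (ξ_k)₁(ξ_k)₂(ξ_k)₃} equals the convex hull (in ℝ⁴) of the graph {(x₁x₂x₃, x₁, x₂, x₃) : (x₁, x₂, x₃) ∈ [l₁,u₁]×[l₂,u₂]×[l₃,u₃]} of the trilinear function x₁x₂x₃ over the box. -/
open Finset Real

noncomputable section

/-- The extreme-point set is the set of convex combinations of the lifted vertices, hence convex. -/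
theorem convex_triConv (l1 u1 l2 u2 l3 u3 : ℝ) :
    Convex ℝ {q : ℝ × ℝ × ℝ × ℝ | ∃ lam : Fin 8 → ℝ, lam ∈ stdSimplex ℝ (Fin 8) ∧
      q.2 = ∑ k, lam k • xiC l1 u1 l2 u2 l3 u3 k ∧
      q.1 = ∑ k, lam k * tri (xiC l1 u1 l2 u2 l3 u3 k)} := by
  rintro p ⟨lam, hlam, hp, hp'⟩ q ⟨mu, hmu, hq, hq'⟩ a b ha hb hab
  refine ⟨a • lam + b • mu, convex_stdSimplex ℝ (Fin 8) hlam hmu ha hb hab, ?_, ?_⟩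
  · simp only [Prod.snd_add, Prod.smul_snd, hp, hq, Pi.add_apply, Pi.smul_apply, smul_eq_mul,
      add_smul, mul_smul, Finset.sum_add_distrib, Finset.smul_sum]
  · simp only [Prod.fst_add, Prod.smul_fst, hp', hq', Pi.add_apply, Pi.smul_apply, smul_eq_mul,
      add_mul, mul_assoc, Finset.sum_add_distrib, Finset.mul_sum]

theorem xiC_mem_box {l1 u1 l2 u2 l3 u3 : ℝ} (h1 : l1 ≤ u1) (h2 : l2 ≤ u2) (h3 : l3 ≤ u3)
    (k : Fin 8) :
    (xiC l1 u1 l2 u2 l3 u3 k).1 ∈ Set.Icc l1 u1 ∧ (xiC l1 u1 l2 u2 l3 u3 k).2.1 ∈ Set.Icc l2 u2 ∧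
      (xiC l1 u1 l2 u2 l3 u3 k).2.2 ∈ Set.Icc l3 u3 := by
  fin_cases k <;> simp [xiC, h1, h2, h3]

/-- Every point of the graph of the trilinear function is the convex combination of the lifted
vertices whose weights are the products of the barycentric coordinates in each interval. -/
theorem exists_weights_of_mem_box {l1 u1 l2 u2 l3 u3 : ℝ} (h1 : l1 ≤ u1) (h2 : l2 ≤ u2)
    (h3 : l3 ≤ u3) {p : ℝ × ℝ × ℝ} (hp1 : p.1 ∈ Set.Icc l1 u1) (hp2 : p.2.1 ∈ Set.Icc l2 u2)
    (hp3 : p.2.2 ∈ Set.Icc l3 u3) :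
    ∃ lam : Fin 8 → ℝ, lam ∈ stdSimplex ℝ (Fin 8) ∧
      p = ∑ k, lam k • xiC l1 u1 l2 u2 l3 u3 k ∧
      tri p = ∑ k, lam k * tri (xiC l1 u1 l2 u2 l3 u3 k) := by
  obtain ⟨x, y, z⟩ := p
  obtain ⟨a, a', ha, ha', haa, rfl⟩ := (Convex.mem_Icc h1).1 hp1
  obtain ⟨b, b', hb, hb', hbb, rfl⟩ := (Convex.mem_Icc h2).1 hp2
  obtain ⟨c, c', hc, hc', hcc, rfl⟩ := (Convex.mem_Icc h3).1 hp3
  obtain rfl := eq_sub_of_add_eq' haa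
  obtain rfl := eq_sub_of_add_eq' hbb
  obtain rfl := eq_sub_of_add_eq' hcc
  refine ⟨![a * b * c, a * b * (1 - c), a * (1 - b) * c, a * (1 - b) * (1 - c),
    (1 - a) * b * c, (1 - a) * b * (1 - c), (1 - a) * (1 - b) * c, (1 - a) * (1 - b) * (1 - c)],
    ⟨fun k => ?_, ?_⟩, ?_, ?_⟩
  · fin_cases k <;> simp <;> positivity
  · simp [Fin.sum_univ_eight]
    ring
  · ext <;> simp [Fin.sum_univ_eight, xiC] <;> ring
  · simp [Fin.sum_univ_eight, xiC, tri]
    ring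

/-- TRI-CONV: the extreme-point set equals the convex hull of the
graph of the trilinear function `x₁x₂x₃` over the box. -/
theorem triConv_eq_convexHull (l1 u1 l2 u2 l3 u3 : ℝ)
    (h1 : l1 ≤ u1) (h2 : l2 ≤ u2) (h3 : l3 ≤ u3) :
    {q : ℝ × ℝ × ℝ × ℝ | ∃ lam : Fin 8 → ℝ, lam ∈ stdSimplex ℝ (Fin 8) ∧
        q.2 = ∑ k, lam k • xiC l1 u1 l2 u2 l3 u3 k ∧
        q.1 = ∑ k, lam k * tri (xiC l1 u1 l2 u2 l3 u3 k)} =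
      convexHull ℝ
        ((fun p : ℝ × ℝ × ℝ => (tri p, p)) ''
          {p | p.1 ∈ Set.Icc l1 u1 ∧ p.2.1 ∈ Set.Icc l2 u2 ∧ p.2.2 ∈ Set.Icc l3 u3}) := by
  apply Set.Subset.antisymm
  · rintro ⟨w, p⟩ ⟨lam, ⟨hlam, hsum⟩, hp, hw⟩
    have h : (w, p) = ∑ k, lam k • (tri (xiC l1 u1 l2 u2 l3 u3 k), xiC l1 u1 l2 u2 l3 u3 k) := by
      apply Prod.ext
      · simpa [Prod.fst_sum] using hw
      · simpa [Prod.snd_sum] using hp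
    rw [h]
    exact (convex_convexHull ℝ _).sum_mem (fun k _ => hlam k) hsum fun k _ =>
      subset_convexHull ℝ _ ⟨_, xiC_mem_box h1 h2 h3 k, rfl⟩
  · refine convexHull_min ?_ (convex_triConv l1 u1 l2 u2 l3 u3)
    rintro _ ⟨p, ⟨hp1, hp2, hp3⟩, rfl⟩
    exact exists_weights_of_mem_box h1 h2 h3 hp1 hp2 hp3
end
end

section
/- (Vertex representation of the convex hull of the sum of trilinear terms) The convex hull of the graph of φ over the whole box equals the convex hull of its graph over the vertices of the box: convexHull ℝ {(φ(x), x) : x ∈ B} = S, where S is the convex hull of the 16 points {(φ(γ), γ) : γ a vertex of B}. (This holds because φ is multilinear, i.e. affine in each coordinate separately.) -/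
open Finset Real

noncomputable section

/-- A convex set containing the values at `l` and `u` of a curve that is affine on `[l, u]`
contains the whole curve. -/
theorem Convex.mem_of_affine_on_Icc {E : Type*} [AddCommGroup E] [Module ℝ E] {K : Set E}
    (hK : Convex ℝ K) {f : ℝ → E} {l u x : ℝ}
    (hf : ∀ a b : ℝ, 0 ≤ a → 0 ≤ b → a + b = 1 →
      f (a * l + b * u) = a • f l + b • f u)
    (hx : x ∈ Set.Icc l u) (hl : f l ∈ K) (hu : f u ∈ K) : f x ∈ K := by
  rw [← segment_eq_Icc (hx.1.trans hx.2)] at hx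
  obtain ⟨a, b, ha, hb, hab, rfl⟩ := hx
  simpa only [smul_eq_mul, hf a b ha hb hab] using hK hl hu ha hb hab

/-- The vertices of a nonempty box belong to the box. -/
theorem vertB_subset_boxB {l1 u1 l2 u2 l3 u3 l4 u4 : ℝ}
    (h1 : l1 ≤ u1) (h2 : l2 ≤ u2) (h3 : l3 ≤ u3) (h4 : l4 ≤ u4) :
    vertB l1 u1 l2 u2 l3 u3 l4 u4 ⊆ boxB l1 u1 l2 u2 l3 u3 l4 u4 := by
  have mem_Icc {l u x : ℝ} (h : l ≤ u) (hx : x = l ∨ x = u) : x ∈ Set.Icc l u := by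
    rcases hx with rfl | rfl
    exacts [Set.left_mem_Icc.2 h, Set.right_mem_Icc.2 h]
  rintro x ⟨hx1, hx2, hx3, hx4⟩
  exact ⟨mem_Icc h1 hx1, mem_Icc h2 hx2, mem_Icc h3 hx3, mem_Icc h4 hx4⟩

/-- A convex set containing the graph of `phi` over the vertices of a box contains the graph
of `phi` over the whole box. -/
theorem Convex.graph_phi_mem {l1 u1 l2 u2 l3 u3 l4 u4 ac as : ℝ}
    {K : Set (ℝ × ℝ × ℝ × ℝ × ℝ)} (hK : Convex ℝ K)
    (hv : ∀ x ∈ vertB l1 u1 l2 u2 l3 u3 l4 u4, (phi ac as x, x) ∈ K)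
    {x : ℝ × ℝ × ℝ × ℝ} (hx : x ∈ boxB l1 u1 l2 u2 l3 u3 l4 u4) : (phi ac as x, x) ∈ K := by
  obtain ⟨x1, x2, x3, x4⟩ := x
  obtain ⟨hx1, hx2, hx3, hx4⟩ := hx
  have on1 {y2 y3 y4 : ℝ} (h2 : y2 = l2 ∨ y2 = u2) (h3 : y3 = l3 ∨ y3 = u3)
      (h4 : y4 = l4 ∨ y4 = u4) : (phi ac as (x1, y2, y3, y4), x1, y2, y3, y4) ∈ K := by
    refine hK.mem_of_affine_on_Icc (f := fun t => (phi ac as (t, y2, y3, y4), t, y2, y3, y4))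
      ?_ hx1 (hv _ ⟨.inl rfl, h2, h3, h4⟩) (hv _ ⟨.inr rfl, h2, h3, h4⟩)
    intro a b _ _ hab
    obtain rfl := eq_sub_of_add_eq hab
    ext <;> simp [phi] <;> ring
  have on2 {y3 y4 : ℝ} (h3 : y3 = l3 ∨ y3 = u3) (h4 : y4 = l4 ∨ y4 = u4) :
      (phi ac as (x1, x2, y3, y4), x1, x2, y3, y4) ∈ K := by
    refine hK.mem_of_affine_on_Icc (f := fun t => (phi ac as (x1, t, y3, y4), x1, t, y3, y4))
      ?_ hx2 (on1 (.inl rfl) h3 h4) (on1 (.inr rfl) h3 h4)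
    intro a b _ _ hab
    obtain rfl := eq_sub_of_add_eq hab
    ext <;> simp [phi] <;> ring
  have on3 {y4 : ℝ} (h4 : y4 = l4 ∨ y4 = u4) :
      (phi ac as (x1, x2, x3, y4), x1, x2, x3, y4) ∈ K := by
    refine hK.mem_of_affine_on_Icc (f := fun t => (phi ac as (x1, x2, t, y4), x1, x2, t, y4))
      ?_ hx3 (on2 (.inl rfl) h4) (on2 (.inr rfl) h4)
    intro a b _ _ hab
    obtain rfl := eq_sub_of_add_eq hab
    ext <;> simp [phi] <;> ring
  refine hK.mem_of_affine_on_Icc (f := fun t => (phi ac as (x1, x2, x3, t), x1, x2, x3, t))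
    ?_ hx4 (on3 (.inl rfl)) (on3 (.inr rfl))
  intro a b _ _ hab
  obtain rfl := eq_sub_of_add_eq hab
  ext <;> simp [phi] <;> ring

/-- vertex representation: the convex hull of the graph of the
multilinear function `φ` over the box equals the convex hull of its graph over the
vertices of the box. -/
theorem convexHull_graph_eq_Shull (l1 u1 l2 u2 l3 u3 l4 u4 ac as : ℝ)
    (h1 : l1 ≤ u1) (h2 : l2 ≤ u2) (h3 : l3 ≤ u3) (h4 : l4 ≤ u4) :
    convexHull ℝ
        ((fun x => (phi ac as x, x)) '' boxB l1 u1 l2 u2 l3 u3 l4 u4) =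
      Shull l1 u1 l2 u2 l3 u3 l4 u4 ac as := by
  refine (convexHull_min ?_ (convex_convexHull ℝ _)).antisymm
    (convexHull_mono (Set.image_mono (vertB_subset_boxB h1 h2 h3 h4)))
  rintro _ ⟨x, hx, rfl⟩
  exact (convex_convexHull ℝ _).graph_phi_mem
    (fun y hy => subset_convexHull ℝ _ (Set.mem_image_of_mem _ hy)) hx
end
end

section
/- (Validity of the first Lifted Nonlinear Cut, eq. (13a)) For all v_i ∈ [v^l_i, v^u_i], v_j ∈ [v^l_j, v^u_j], and θ ∈ [θ^l, θ^u], the following inequality holds: v^σ_i v^σ_j (w^R cos φ + w^I sin φ) − v^u_j cos(δ) v^σ_j w_i − v^u_i cos(δ) v^σ_i w_j ≥ v^u_i v^u_j cos(δ) (v^l_i v^l_j − v^u_i v^u_j). -/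
open Real

/-- The polynomial inequality behind the first lifted nonlinear cut: on the box
`[a, b] × [c, d]` the quadratic form minus its lower bound is a sum of products of slacks. -/
theorem lifted_cut_polynomial_bound {a b c d x y : ℝ} (ha : 0 ≤ a) (hc : 0 ≤ c)
    (hx : x ∈ Set.Icc a b) (hy : y ∈ Set.Icc c d) :
    b * d * (a * c - b * d) ≤
      (a + b) * (c + d) * (x * y) - d * (c + d) * x ^ 2 - b * (a + b) * y ^ 2 := by
  obtain ⟨hax, hxb⟩ := hx
  obtain ⟨hcy, hyd⟩ := hy
  have hb : 0 ≤ b := by linarith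
  have hd : 0 ≤ d := by linarith
  have hbx := sub_nonneg.2 hxb
  have hdy := sub_nonneg.2 hyd
  have hxa := sub_nonneg.2 hax
  have hyc := sub_nonneg.2 hcy
  have hsum : 0 ≤ (a + b) * (c + d) * ((b - x) * (d - y)) +
      d * (c + d) * ((b - x) * (x - a)) + b * (a + b) * ((d - y) * (y - c)) := by
    positivity
  linear_combination hsum

/-- The cosine of the deviation from the midpoint of `[l, u]` is at least the cosine of its
half-width. -/
theorem cos_half_width_le_cos_sub_midpoint {l u t : ℝ} (hlu : u - l ≤ 2 * π)
    (ht : t ∈ Set.Icc l u) : cos ((u - l) / 2) ≤ cos (t - (u + l) / 2) := by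
  obtain ⟨hl, hu⟩ := ht
  rw [← cos_abs (t - (u + l) / 2)]
  exact cos_le_cos_of_nonneg_of_le_pi (abs_nonneg _) (by linarith)
    (abs_le.2 ⟨by linarith, by linarith⟩)

/-- validity of the first Lifted Nonlinear Cut, eq. (13a). -/
theorem lnc_first_valid (vli vui vlj vuj tl tu : ℝ)
    (hvli : 0 ≤ vli) (hvi : vli ≤ vui) (hvlj : 0 ≤ vlj) (hvj : vlj ≤ vuj)
    (htl : -(π / 2) ≤ tl) (htlu : tl ≤ tu) (htu : tu ≤ π / 2)
    (vi vj t : ℝ)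
    (hvi' : vi ∈ Set.Icc vli vui) (hvj' : vj ∈ Set.Icc vlj vuj)
    (ht : t ∈ Set.Icc tl tu) :
    (vli + vui) * (vlj + vuj) *
        ((vi * vj * cos t) * cos ((tu + tl) / 2) + (vi * vj * sin t) * sin ((tu + tl) / 2))
      - vuj * cos ((tu - tl) / 2) * (vlj + vuj) * vi ^ 2
      - vui * cos ((tu - tl) / 2) * (vli + vui) * vj ^ 2
      ≥ vui * vuj * cos ((tu - tl) / 2) * (vli * vlj - vui * vuj) := by
  have hcos : cos ((tu - tl) / 2) ≤ cos (t - (tu + tl) / 2) :=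
    cos_half_width_le_cos_sub_midpoint (by linarith [pi_pos]) ht
  have hcos_nonneg : 0 ≤ cos ((tu - tl) / 2) :=
    cos_nonneg_of_mem_Icc ⟨by linarith [pi_pos], by linarith⟩
  have hpoly := mul_le_mul_of_nonneg_left
    (lifted_cut_polynomial_bound hvli hvlj hvi' hvj') hcos_nonneg
  have hvi_nonneg : 0 ≤ vi := hvli.trans hvi'.1
  have hvj_nonneg : 0 ≤ vj := hvlj.trans hvj'.1
  have hvui : 0 ≤ vui := hvli.trans hvi
  have hvuj : 0 ≤ vuj := hvlj.trans hvj
  have hmul := mul_le_mul_of_nonneg_left hcos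
    (show 0 ≤ (vli + vui) * (vlj + vuj) * (vi * vj) by positivity)
  rw [cos_sub t] at hmul
  linear_combination hpoly + hmul
end

section
/- (Validity of the second Lifted Nonlinear Cut, eq. (13b)) For all v_i ∈ [v^l_i, v^u_i], v_j ∈ [v^l_j, v^u_j], and θ ∈ [θ^l, θ^u], the following inequality holds: v^σ_i v^σ_j (w^R cos φ + w^I sin φ) − v^l_j cos(δ) v^σ_j w_i − v^l_i cos(δ) v^σ_i w_j ≥ v^l_i v^l_j cos(δ) (v^u_i v^u_j − v^l_i v^l_j). -/
open Real

/-- The polynomial core of the cut: the slack is a sum of products of nonnegative bound gaps. -/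
theorem lnc_polynomial_bound {a b c d x y : ℝ} (ha : 0 ≤ a) (hc : 0 ≤ c)
    (hx : x ∈ Set.Icc a b) (hy : y ∈ Set.Icc c d) :
    a * c * (b * d - a * c) ≤
      (a + b) * (c + d) * (x * y) - c * (c + d) * x ^ 2 - a * (a + b) * y ^ 2 := by
  have hxa := sub_nonneg.2 hx.1
  have hbx := sub_nonneg.2 hx.2
  have hyc := sub_nonneg.2 hy.1
  have hdy := sub_nonneg.2 hy.2
  have hS : 0 ≤ a + b := by linarith
  have hT : 0 ≤ c + d := by linarith
  have h₁ : 0 ≤ c * (c + d) * ((x - a) * (b - x)) := by positivity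
  have h₂ : 0 ≤ a * (a + b) * ((y - c) * (d - y)) := by positivity
  have h₃ : 0 ≤ (a + b) * (c + d) * ((x - a) * (y - c)) := by positivity
  linear_combination h₁ + h₂ + h₃

/-- On an interval of length at most `2π`, the cosine of the distance to the midpoint is least at
the endpoints. -/
theorem cos_half_sub_le_cos_sub_midpoint {l u t : ℝ} (h : u - l ≤ 2 * π)
    (ht : t ∈ Set.Icc l u) : cos ((u - l) / 2) ≤ cos (t - (u + l) / 2) := by
  rw [← cos_abs (t - _)]
  refine cos_le_cos_of_nonneg_of_le_pi (abs_nonneg _) (by linarith) ?_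
  rw [abs_le]
  constructor <;> linarith [ht.1, ht.2]

/-- validity of the second Lifted Nonlinear Cut, eq. (13b). -/
theorem lnc_second_valid (vli vui vlj vuj tl tu : ℝ)
    (hvli : 0 ≤ vli) (hvi : vli ≤ vui) (hvlj : 0 ≤ vlj) (hvj : vlj ≤ vuj)
    (htl : -(π / 2) ≤ tl) (htlu : tl ≤ tu) (htu : tu ≤ π / 2)
    (vi vj t : ℝ)
    (hvi' : vi ∈ Set.Icc vli vui) (hvj' : vj ∈ Set.Icc vlj vuj)
    (ht : t ∈ Set.Icc tl tu) :
    (vli + vui) * (vlj + vuj) *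
        ((vi * vj * cos t) * cos ((tu + tl) / 2) + (vi * vj * sin t) * sin ((tu + tl) / 2))
      - vlj * cos ((tu - tl) / 2) * (vlj + vuj) * vi ^ 2
      - vli * cos ((tu - tl) / 2) * (vli + vui) * vj ^ 2
      ≥ vli * vlj * cos ((tu - tl) / 2) * (vui * vuj - vli * vlj) := by
  have hcos := cos_half_sub_le_cos_sub_midpoint (by linarith [pi_pos]) ht
  have hδ : 0 ≤ cos ((tu - tl) / 2) :=
    cos_nonneg_of_neg_pi_div_two_le_of_le (by linarith [pi_pos]) (by linarith)
  have hpoly := mul_le_mul_of_nonneg_left (lnc_polynomial_bound hvli hvlj hvi' hvj') hδ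
  have hcoef : 0 ≤ (vli + vui) * (vlj + vuj) * (vi * vj) :=
    mul_nonneg (mul_nonneg (by linarith) (by linarith))
      (mul_nonneg (hvli.trans hvi'.1) (hvlj.trans hvj'.1))
  have hprod := mul_le_mul_of_nonneg_left hcos hcoef
  rw [cos_sub] at hprod
  linear_combination hpoly + hprod
end

section
/- (Validity of the quadratic over-estimator of cosine in C-CONV) For every real m with 0 < m ≤ π/2 and every real x with |x| ≤ m, one has cos x ≤ 1 − ((1 − cos m)/m²)·x². -/
open Real

theorem mul_sin_le_sin_mul {t a : ℝ} (ht0 : 0 ≤ t) (ht1 : t ≤ 1) (ha0 : 0 ≤ a) (ha : a ≤ π) :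
    t * sin a ≤ sin (t * a) := by
  simpa using strictConcaveOn_sin_Icc.concaveOn.2 ⟨le_rfl, pi_pos.le⟩ ⟨ha0, ha⟩
    (sub_nonneg.2 ht1) ht0 (sub_add_cancel 1 t)

theorem one_sub_cos_eq_two_mul_sin_half_sq (x : ℝ) : 1 - cos x = 2 * sin (x / 2) ^ 2 := by
  rw [sin_sq_eq_half_sub, mul_div_cancel₀ x two_ne_zero]
  ring

/-- quadratic over-estimator of cosine in C-CONV: for `0 < m ≤ π/2`
and `|x| ≤ m`, `cos x ≤ 1 - ((1 - cos m)/m²)·x²`. -/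
theorem cos_le_quadratic_overestimator (m x : ℝ)
    (hm0 : 0 < m) (hm : m ≤ π / 2) (hx : |x| ≤ m) :
    cos x ≤ 1 - (1 - cos m) / m ^ 2 * x ^ 2 := by
  have hpi := pi_pos
  have hsin : |x| / m * sin (m / 2) ≤ sin (|x| / 2) := by
    convert mul_sin_le_sin_mul (div_nonneg (abs_nonneg x) hm0.le) ((div_le_one hm0).2 hx)
      (half_pos hm0).le (by linarith) using 2
    field_simp
  have hsin_nonneg : 0 ≤ sin (m / 2) := sin_nonneg_of_nonneg_of_le_pi (by linarith) (by linarith)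
  suffices (1 - cos m) / m ^ 2 * x ^ 2 ≤ 1 - cos x by linarith
  calc (1 - cos m) / m ^ 2 * x ^ 2 = 2 * (|x| / m * sin (m / 2)) ^ 2 := by
        rw [one_sub_cos_eq_two_mul_sin_half_sq, mul_pow, div_pow, sq_abs]
        ring
    _ ≤ 2 * sin (|x| / 2) ^ 2 := by gcongr
    _ = 1 - cos x := by rw [← one_sub_cos_eq_two_mul_sin_half_sq, cos_abs]
end

section
/- (Validity of the upper tangent bound on sine in S-CONV) For every real m with 0 < m ≤ π/2 and every real x with |x| ≤ m, one has sin x ≤ cos(m/2)·(x − m/2) + sin(m/2). -/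
open Real

/-- The Huygens inequality. -/
theorem three_mul_le_tan_add_two_mul_sin {a : ℝ} (h0 : 0 ≤ a) (h1 : a < π / 2) :
    3 * a ≤ tan a + 2 * sin a := by
  have hcos : ∀ y ∈ Set.Icc 0 a, 0 < cos y := fun y hy =>
    cos_pos_of_mem_Ioo ⟨by linarith [hy.1, pi_pos], by linarith [hy.2]⟩
  have hd : ∀ y ∈ Set.Icc 0 a, HasDerivAt (fun y => tan y + 2 * sin y - 3 * y)
      (1 / cos y ^ 2 + 2 * cos y - 3 * 1) y := fun y hy =>
    ((hasDerivAt_tan (hcos y hy).ne').add ((hasDerivAt_sin y).const_mul 2)).sub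
      ((hasDerivAt_id y).const_mul 3)
  have hmono : MonotoneOn (fun y => tan y + 2 * sin y - 3 * y) (Set.Icc 0 a) := by
    refine monotoneOn_of_deriv_nonneg (convex_Icc 0 a)
      (fun y hy => (hd y hy).continuousAt.continuousWithinAt)
      (fun y hy => (hd y (interior_subset hy)).differentiableAt.differentiableWithinAt)
      fun y hy => ?_
    have hc := hcos y (interior_subset hy)
    rw [(hd y (interior_subset hy)).deriv]
    have key : 1 / cos y ^ 2 + 2 * cos y - 3 * 1
        = (1 - cos y) ^ 2 * (1 + 2 * cos y) / cos y ^ 2 := by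
      field_simp
      ring
    rw [key]
    positivity
  have := hmono (Set.left_mem_Icc.2 h0) (Set.right_mem_Icc.2 h0) h0
  simp only [tan_zero, sin_zero] at this
  linarith

theorem mul_cos_le_sin {w : ℝ} (h0 : 0 ≤ w) (h1 : w < π / 2) : w * cos w ≤ sin w := by
  have hc : 0 < cos w := cos_pos_of_mem_Ioo ⟨by linarith [pi_pos], h1⟩
  have h := le_tan h0 h1
  rwa [tan_eq_sin_div_cos, le_div_iff₀ hc] at h

/-- upper tangent bound on sine in S-CONV: for `0 < m ≤ π/2` and
`|x| ≤ m`, `sin x ≤ cos(m/2)·(x - m/2) + sin(m/2)`. -/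
theorem sin_le_upper_tangent (m x : ℝ)
    (hm0 : 0 < m) (hm : m ≤ π / 2) (hx : |x| ≤ m) :
    sin x ≤ cos (m / 2) * (x - m / 2) + sin (m / 2) := by
  obtain ⟨hx1, hx2⟩ := abs_le.1 hx
  have hpi := pi_pos
  obtain ⟨a, rfl⟩ : ∃ a, m = 2 * a := ⟨m / 2, by ring⟩
  rw [mul_div_cancel_left₀ a (two_ne_zero : (2 : ℝ) ≠ 0)]
  have hca : 0 < cos a := cos_pos_of_mem_Ioo ⟨by linarith, by linarith⟩
  have hsa : 0 ≤ sin a := sin_nonneg_of_nonneg_of_le_pi (by linarith) (by linarith)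
  rcases le_total a x with h | h
  · have e : sin x = sin a * cos (x - a) + cos a * sin (x - a) := by
      rw [← sin_add]; congr 1; ring
    have h1 := mul_le_mul_of_nonneg_left (sin_le (sub_nonneg.2 h)) hca.le
    have h2 := mul_le_mul_of_nonneg_left (cos_le_one (x - a)) hsa
    linarith
  rcases le_total (-a) x with h' | h'
  · obtain ⟨w, rfl⟩ : ∃ w, x = a - 2 * w := ⟨(a - x) / 2, by ring⟩
    have hcw : 0 < cos w := cos_pos_of_mem_Ioo ⟨by linarith, by linarith⟩
    have hsw : 0 ≤ sin w := sin_nonneg_of_nonneg_of_le_pi (by linarith) (by linarith)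
    have hd : 0 ≤ sin (a - w) := sin_nonneg_of_nonneg_of_le_pi (by linarith) (by linarith)
    rw [sin_sub] at hd
    have h1 := mul_le_mul_of_nonneg_left
      (mul_cos_le_sin (w := w) (by linarith) (by linarith)) hca.le
    have h2 := mul_nonneg hsw hd
    have hs := sin_sq_add_cos_sq w
    have h3 : w * cos a ≤ sin w * (cos a * cos w + sin a * sin w) := by
      refine le_of_mul_le_mul_right ?_ hcw
      have : sin w * (cos a * cos w + sin a * sin w) * cos w
          = sin w * cos a + sin w * (sin w * (sin a * cos w - cos a * sin w)) := by
        linear_combination (sin w * cos a) * hs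
      have h4 := mul_nonneg hsw h2
      linarith
    have e : sin (a - 2 * w) = sin a - 2 * (sin w * (cos a * cos w + sin a * sin w)) := by
      rw [sin_sub, sin_two_mul, cos_two_mul]
      linear_combination 2 * sin a * hs
    rw [e]
    linarith
  · obtain ⟨w, rfl⟩ : ∃ w, x = 2 * w - 2 * a := ⟨(x + 2 * a) / 2, by ring⟩
    have hc : cos (2 * a - w) ≤ cos a :=
      cos_le_cos_of_nonneg_of_le_pi (by linarith) (by linarith) (by linarith)
    have hw : sin w ≤ w := sin_le (by linarith)
    have hc0 : 0 ≤ cos (2 * a - w) := cos_nonneg_of_mem_Icc ⟨by linarith, by linarith⟩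
    have h1 : sin w * cos (2 * a - w) ≤ w * cos a :=
      mul_le_mul hw hc hc0 (by linarith)
    have e : sin (2 * w - 2 * a) = 2 * (sin w * cos (2 * a - w)) - sin (2 * a) := by
      have e1 : 2 * w - 2 * a = w - (2 * a - w) := by ring
      have e2 : sin (2 * a) = sin (w + (2 * a - w)) := by congr 1; ring
      rw [e1, e2, sin_sub, sin_add]
      ring
    have hH := mul_le_mul_of_nonneg_right
      (three_mul_le_tan_add_two_mul_sin (a := a) (by linarith) (by linarith)) hca.le
    rw [add_mul, tan_mul_cos hca.ne'] at hH
    rw [e, sin_two_mul]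
    linarith
end
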